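/- Let H be an m×n complex matrix, y ∈ ℂ^m, η > 0, A = H^H H + ηI, and x* = A^{-1} H^H y. If x : ℝ → ℂ^n is differentiable and satisfies dx(t)/dt = −A x(t) + H^H y for all t ≥ 0, then x(t) converges to x* as t → ∞; in particular, the ODE-MMSE trajectory converges to the unique minimizer of the objective f(x) = ‖y − Hx‖² + η‖x‖². -/

import Mathlib

open Matrix Filter

/-- The regularized least-squares objective `f(x) = ‖y − Hx‖² + η‖x‖²`. -/
noncomputable def rlsObjective5 (m n : ℕ) (H : Matrix (Fin m) (Fin n) ℂ)
    (y : Fin m → ℂ) (η : ℝ) (x : Fin n → ℂ) : ℝ :=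
  (∑ i, ‖(y - H *ᵥ x) i‖ ^ 2) + η * ∑ j, ‖x j‖ ^ 2

theorem sum_norm_sq_eq_re_dotProduct {ι : Type*} [Fintype ι] (v : ι → ℂ) :
    ∑ i, ‖v i‖ ^ 2 = (star v ⬝ᵥ v).re := by
  simp [dotProduct, Complex.sq_norm, Complex.normSq_apply]

theorem sum_norm_add_sq {ι : Type*} [Fintype ι] (u v : ι → ℂ) :
    ∑ i, ‖(u + v) i‖ ^ 2 = ∑ i, ‖u i‖ ^ 2 + 2 * (star v ⬝ᵥ u).re + ∑ i, ‖v i‖ ^ 2 := by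
  simp only [dotProduct, Complex.re_sum, Finset.mul_sum, ← Finset.sum_add_distrib]
  refine Finset.sum_congr rfl fun i _ => ?_
  simp [Complex.sq_norm, Complex.normSq_apply]
  ring

theorem star_dotProduct_conjTranspose_mulVec {ι κ : Type*} [Fintype ι] [Fintype κ]
    (H : Matrix ι κ ℂ) (v : κ → ℂ) (w : ι → ℂ) :
    star v ⬝ᵥ (Hᴴ *ᵥ w) = star (H *ᵥ v) ⬝ᵥ w := by
  rw [dotProduct_mulVec, star_mulVec]

theorem re_dotProduct_regularizedGram {ι κ : Type*} [Fintype ι] [Fintype κ] [DecidableEq κ]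
    (H : Matrix ι κ ℂ) (η : ℝ) (v : κ → ℂ) :
    (star v ⬝ᵥ ((Hᴴ * H + (η : ℂ) • 1) *ᵥ v)).re =
      ∑ i, ‖(H *ᵥ v) i‖ ^ 2 + η * ∑ j, ‖v j‖ ^ 2 := by
  rw [add_mulVec, dotProduct_add, ← mulVec_mulVec, star_dotProduct_conjTranspose_mulVec,
    smul_mulVec, one_mulVec, dotProduct_smul, sum_norm_sq_eq_re_dotProduct,
    sum_norm_sq_eq_re_dotProduct]
  simp

open scoped ComplexOrder in
theorem regularizedGram_isUnit_det {ι κ : Type*} [Fintype ι] [Fintype κ] [DecidableEq κ]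
    (H : Matrix ι κ ℂ) {η : ℝ} (hη : 0 < η) : IsUnit (Hᴴ * H + (η : ℂ) • 1).det := by
  rw [← isUnit_iff_isUnit_det]
  have h1 : ((η : ℂ) • (1 : Matrix κ κ ℂ)).PosDef :=
    PosDef.one.smul (by exact_mod_cast hη)
  exact (PosDef.posSemidef_add (posSemidef_conjTranspose_mul_self H) h1).isUnit

theorem rlsObjective5_add {m n : ℕ} (H : Matrix (Fin m) (Fin n) ℂ) (y : Fin m → ℂ) (η : ℝ)
    {p : Fin n → ℂ} (hp : (Hᴴ * H + (η : ℂ) • 1) *ᵥ p = Hᴴ *ᵥ y) (e : Fin n → ℂ) :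
    rlsObjective5 m n H y η (p + e) =
      rlsObjective5 m n H y η p + (∑ i, ‖(H *ᵥ e) i‖ ^ 2 + η * ∑ j, ‖e j‖ ^ 2) := by
  have hcross : (star (H *ᵥ e) ⬝ᵥ (H *ᵥ p)).re + η * (star e ⬝ᵥ p).re =
      (star (H *ᵥ e) ⬝ᵥ y).re := by
    rw [← star_dotProduct_conjTranspose_mulVec H e y, ← hp, add_mulVec, dotProduct_add,
      ← mulVec_mulVec, star_dotProduct_conjTranspose_mulVec, smul_mulVec, one_mulVec,
      dotProduct_smul]
    simp
  have hres : y - H *ᵥ (p + e) = (y - H *ᵥ p) + -(H *ᵥ e) := by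
    rw [mulVec_add]; abel
  unfold rlsObjective5
  rw [hres, sum_norm_add_sq, sum_norm_add_sq, star_neg, neg_dotProduct, dotProduct_sub]
  simp only [Pi.neg_apply, norm_neg, Complex.neg_re, Complex.sub_re]
  linear_combination 2 * hcross

theorem HasDerivAt.sum_norm_sq {ι : Type*} [Fintype ι] {e : ℝ → ι → ℂ} {e' : ι → ℂ} {t : ℝ}
    (h : HasDerivAt e e' t) :
    HasDerivAt (fun s => ∑ j, ‖e s j‖ ^ 2) (2 * (star (e t) ⬝ᵥ e').re) t := by
  have hsum := HasDerivAt.fun_sum (u := Finset.univ) fun j _ => (hasDerivAt_pi.1 h j).norm_sq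
  refine hsum.congr_deriv ?_
  simp [dotProduct, Finset.mul_sum, Complex.inner, mul_comm]

theorem tendsto_zero_of_hasDerivAt_le_neg_mul {V V' : ℝ → ℝ} {c : ℝ} (hc : 0 < c)
    (hV : ∀ t, 0 ≤ V t) (hd : ∀ t, 0 ≤ t → HasDerivAt V (V' t) t)
    (hle : ∀ t, 0 ≤ t → V' t ≤ -(c * V t)) : Tendsto V atTop (nhds 0) := by
  have hderiv : ∀ t, 0 ≤ t → HasDerivAt (fun s => Real.exp (c * s) * V s)
      (Real.exp (c * t) * (c * V t + V' t)) t := fun t ht => by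
    have hexp : HasDerivAt (fun s => Real.exp (c * s)) (Real.exp (c * t) * c) t := by
      simpa using ((hasDerivAt_id t).const_mul c).exp
    exact (hexp.mul (hd t ht)).congr_deriv (by ring)
  have hanti : AntitoneOn (fun s => Real.exp (c * s) * V s) (Set.Ici 0) := by
    refine antitoneOn_of_hasDerivWithinAt_nonpos (convex_Ici 0)
      (fun t ht => (hderiv t ht).continuousAt.continuousWithinAt)
      (fun t ht => (hderiv t (interior_subset ht)).hasDerivWithinAt) fun t ht => ?_
    have := hle t (interior_subset ht)
    exact mul_nonpos_of_nonneg_of_nonpos (Real.exp_pos _).le (by linarith)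
  have hlim : Tendsto (fun t => V 0 * Real.exp (-(c * t))) atTop (nhds 0) := by
    simpa using (Real.tendsto_exp_neg_atTop_nhds_zero.comp
      (tendsto_id.const_mul_atTop hc)).const_mul (V 0)
  refine tendsto_of_tendsto_of_tendsto_of_le_of_le' tendsto_const_nhds hlim
    (Eventually.of_forall hV) ?_
  filter_upwards [eventually_ge_atTop 0] with t ht
  have h := hanti Set.self_mem_Ici (Set.mem_Ici.2 ht) ht
  simp only [mul_zero, Real.exp_zero, one_mul] at h
  rw [Real.exp_neg, ← div_eq_mul_inv, le_div_iff₀ (Real.exp_pos _), mul_comm]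
  exact h

theorem tendsto_zero_of_sum_norm_sq {ι α : Type*} [Fintype ι] {l : Filter α} {e : α → ι → ℂ}
    (h : Tendsto (fun t => ∑ j, ‖e t j‖ ^ 2) l (nhds 0)) : Tendsto e l (nhds 0) := by
  refine tendsto_pi_nhds.2 fun j => tendsto_zero_iff_norm_tendsto_zero.2 ?_
  have hsq : Tendsto (fun t => ‖e t j‖ ^ 2) l (nhds 0) :=
    squeeze_zero (fun t => sq_nonneg _) (fun t => Finset.single_le_sum
      (f := fun k => ‖e t k‖ ^ 2) (fun k _ => sq_nonneg _) (Finset.mem_univ j)) h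
  simpa using hsq.sqrt

/-- Any solution of the ODE `dx/dt = −Ax(t) + Hᴴy` (with `A = HᴴH + ηI`)
converges to `x* = A⁻¹Hᴴy` as `t → ∞`; in particular the trajectory converges
to the unique minimizer of `f(x) = ‖y − Hx‖² + η‖x‖²`. -/
theorem stmt5 (m n : ℕ) (H : Matrix (Fin m) (Fin n) ℂ) (y : Fin m → ℂ)
    (η : ℝ) (hη : 0 < η)
    (A : Matrix (Fin n) (Fin n) ℂ) (hA : A = Hᴴ * H + (η : ℂ) • 1)
    (xstar : Fin n → ℂ) (hxstar : xstar = A⁻¹ *ᵥ (Hᴴ *ᵥ y))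
    (x : ℝ → Fin n → ℂ)
    (hx : ∀ t : ℝ, 0 ≤ t → HasDerivAt x (-(A *ᵥ x t) + Hᴴ *ᵥ y) t) :
    Tendsto x atTop (nhds xstar) ∧
    (∀ z : Fin n → ℂ, z ≠ xstar →
      rlsObjective5 m n H y η xstar < rlsObjective5 m n H y η z) := by
  subst hA
  have hcrit : (Hᴴ * H + (η : ℂ) • 1) *ᵥ xstar = Hᴴ *ᵥ y := by
    rw [hxstar, mulVec_mulVec, mul_nonsing_inv _ (regularizedGram_isUnit_det H hη), one_mulVec]
  refine ⟨?_, fun z hz => ?_⟩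
  · have herr : ∀ t, 0 ≤ t → HasDerivAt (fun s => x s - xstar)
        (-((Hᴴ * H + (η : ℂ) • 1) *ᵥ (x t - xstar))) t := fun t ht => by
      refine ((hx t ht).sub_const xstar).congr_deriv ?_
      rw [mulVec_sub, hcrit]
      abel
    have hV : Tendsto (fun t => ∑ j, ‖(x t - xstar) j‖ ^ 2) atTop (nhds 0) := by
      refine tendsto_zero_of_hasDerivAt_le_neg_mul (c := 2 * η) (by positivity)
        (fun t => by positivity) (fun t ht => (herr t ht).sum_norm_sq) fun t _ => ?_
      rw [dotProduct_neg, Complex.neg_re, re_dotProduct_regularizedGram]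
      have : 0 ≤ ∑ i, ‖(H *ᵥ (x t - xstar)) i‖ ^ 2 := by positivity
      linarith
    exact tendsto_sub_nhds_zero_iff.1 (tendsto_zero_of_sum_norm_sq hV)
  · have hpos : 0 < ∑ j, ‖(z - xstar) j‖ ^ 2 := by
      obtain ⟨j, hj⟩ := Function.ne_iff.1 (sub_ne_zero.2 hz)
      exact Finset.sum_pos' (fun k _ => sq_nonneg _)
        ⟨j, Finset.mem_univ j, pow_pos (norm_pos_iff.2 hj) 2⟩
    have hH : 0 ≤ ∑ i, ‖(H *ᵥ (z - xstar)) i‖ ^ 2 := by positivity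
    have hval := rlsObjective5_add H y η hcrit (z - xstar)
    rw [add_sub_cancel] at hval
    rw [hval]
    linarith [mul_pos hη hpos]
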